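/- Let p_1, p_2 be two distinct primes and let m, a, b be positive integers with m > 2. Let q_1,...,q_t be t distinct primes each dividing (m−1)·p_1^{2a} + 1. If p_2 is self-conjugate modulo q_1···q_t and q_1···q_t·p_2^b > 2^{t−1}·((m−1)·p_1^{2a} + 1), then there does not exist an ((m−1)·p_1^{2a}+1, m, p_1^a·p_2^b, p_2^{2b})-SEDF in any finite abelian group. -/

import Mathlib

/-- A `(v,m,k,λ)`-strong external difference family in a finite abelian group `G`. -/
def IsSEDF {G : Type*} [CommGroup G] [Fintype G] [DecidableEq G]
    {m : ℕ} (D : Fin m → Finset G) (k lam : ℕ) : Prop :=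
  0 < m ∧ 0 < k ∧ 0 < lam ∧
  (∀ i, (D i).card = k) ∧
  (∀ i j, i ≠ j → Disjoint (D i) (D j)) ∧
  ∀ j : Fin m, ∀ g : G,
    (∑ l ∈ Finset.univ.filter (fun l => l ≠ j),
      (((D l) ×ˢ (D j)).filter (fun x => x.1 * x.2⁻¹ = g)).card)
    = if g = 1 then 0 else lam

/-- A prime `p` is self-conjugate modulo `w`: writing `w = p^s · u'` with `gcd(u',p) = 1`,
there exists `r` with `p^r ≡ -1 (mod u')`. -/
def SelfConjPrime (p w : ℕ) : Prop :=
  ∃ r : ℕ, (p : ZMod (w / p ^ w.factorization p)) ^ r = -1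

open ComplexConjugate in
lemma exists_rational_normSq_of_strong_sum {m : ℕ} (hm : 2 < m) (z : Fin m → ℂ) {L : ℕ}
    (hL : 0 < L) (h : ∀ j, (∑ i, z i - z j) * conj (z j) = -(L : ℂ)) :
    ∃ j j' : Fin m, ∃ r r' : ℚ, Complex.normSq (z j) = r ∧ Complex.normSq (z j') = r' ∧
      r * r' = (L : ℚ) ^ 2 ∧ (L : ℚ) ≤ r := by
  set S := ∑ i, z i with hS
  have hLr : (0 : ℝ) < L := by exact_mod_cast hL
  have hn : ∀ j, S * conj (z j) = ((Complex.normSq (z j) - L : ℝ) : ℂ) := by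
    intro j
    have := h j
    rw [sub_mul, Complex.mul_conj] at this
    push_cast
    linear_combination this
  by_cases hS0 : S = 0
  · have j0 : Fin m := ⟨0, by omega⟩
    have h1 : Complex.normSq (z j0) = L := by
      have := hn j0
      rw [hS0, zero_mul] at this
      have : Complex.normSq (z j0) - L = 0 := by exact_mod_cast this.symm
      linarith
    exact ⟨j0, j0, L, L, by simpa using h1, by simpa using h1, by ring, le_rfl⟩
  set X := Complex.normSq S with hX
  have hXpos : 0 < X := Complex.normSq_pos.2 hS0
  set r : Fin m → ℝ := fun j => Complex.normSq (z j) - L with hr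
  have hsum : ∑ j, r j = X := by
    have : ((∑ j, r j : ℝ) : ℂ) = X := by
      rw [Complex.ofReal_sum, hX, ← Complex.mul_conj, ← Finset.sum_congr rfl fun j _ => hn j,
        ← Finset.mul_sum, ← map_sum]
    exact_mod_cast this
  have hquad : ∀ j, r j ^ 2 = X * (r j + L) := by
    intro j
    have h1 := congrArg Complex.normSq (hn j)
    rw [Complex.normSq_mul, Complex.normSq_conj, Complex.normSq_ofReal] at h1
    simp only [hr]
    rw [sq, ← h1]; ring
  have hpair : ∀ i j, r i ≠ r j → r i + r j = X := by
    intro i j hij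
    have : (r i - r j) * (r i + r j - X) = 0 := by linear_combination hquad i - hquad j
    rcases mul_eq_zero.1 this with h0 | h0
    · exact absurd (sub_eq_zero.1 h0) hij
    · linarith
  have hne0 : ∀ j, r j ≠ 0 := by
    intro j h0
    have := hquad j
    rw [h0] at this
    nlinarith
  have hpos : ∃ j, 0 < r j := by
    by_contra! hc
    have := Finset.sum_nonpos fun j (_ : j ∈ Finset.univ) => hc j
    linarith
  obtain ⟨i, hi⟩ := hpos
  have hneg : ∃ j, r j < 0 := by
    by_contra! hc
    have heq : ∀ j, r j = r i := by
      intro j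
      by_contra hij
      have h1 := hpair j i hij
      have h2 : r j * r i = -(L * X) := by
        linear_combination r i * h1 - hquad i
      nlinarith [hc j]
    rw [Finset.sum_congr rfl fun j _ => heq j] at hsum
    simp only [Finset.sum_const, Finset.card_univ, Fintype.card_fin, nsmul_eq_mul] at hsum
    have h3 := hquad i
    have : (1 : ℝ) ≤ m := by exact_mod_cast (by omega : 1 ≤ m)
    nlinarith [mul_pos hXpos hLr]
  obtain ⟨j, hj⟩ := hneg
  have hij := hpair i j (by linarith)
  have hmul : r i * r j = -(L * X) := by linear_combination r i * hij - hquad i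
  have hval : ∀ l, r l = if 0 < r l then r i else r j := by
    intro l
    split_ifs with hl
    · by_contra hc
      have := hpair l i hc
      have : r l * r i = -(L * X) := by linear_combination r i * this - hquad i
      nlinarith [mul_pos hl hi]
    · by_contra hc
      have hl' : r l < 0 := lt_of_le_of_ne (not_lt.1 hl) (hne0 l)
      have := hpair l j hc
      linarith
  obtain ⟨u, v, huv, hcount⟩ : ∃ u v : ℕ, u + v = m ∧ (u : ℝ) * r i + v * r j = X := by
    refine ⟨_, _, (Finset.card_filter_add_card_filter_not (s := Finset.univ)
      (fun l : Fin m => 0 < r l)).trans (by simp), ?_⟩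
    rw [← hsum, Finset.sum_congr rfl fun l _ => hval l, Finset.sum_ite]
    simp
  have hlin : ((u : ℝ) - 1) * r i + ((v : ℝ) - 1) * r j = 0 := by
    linear_combination hcount - hij
  have huvr : (u : ℝ) + v = m := by exact_mod_cast huv
  have hmr : (2 : ℝ) < m := by exact_mod_cast hm
  have hu1 : (u : ℝ) - 1 ≠ 0 := by
    intro h0
    rw [h0] at hlin
    have : (v : ℝ) - 1 ≠ 0 := by linarith
    have := mul_ne_zero this hj.ne
    apply this; linarith
  have hv1 : (v : ℝ) - 1 ≠ 0 := by
    intro h0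
    rw [h0] at hlin
    have := mul_ne_zero hu1 hi.ne'
    apply this; linarith
  set ρ : ℚ := ((v : ℚ) - 1) / ((u : ℚ) - 1) with hρ
  have hρr : (ρ : ℝ) = ((v : ℝ) - 1) / ((u : ℝ) - 1) := by rw [hρ]; push_cast; ring
  have hρ0 : (ρ : ℝ) ≠ 0 := by rw [hρr]; exact div_ne_zero hv1 hu1
  have hri : r i = -ρ * r j := by
    rw [hρr]; field_simp; linear_combination hlin
  have hrj : r j = ((L * (1 - ρ) / ρ : ℚ) : ℝ) := by
    push_cast
    rw [eq_div_iff hρ0]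
    have h5 : r j * (r j * ρ - L * (1 - ρ)) = 0 := by
      rw [hri] at hmul hij
      linear_combination -hmul - L * hij
    rcases mul_eq_zero.1 h5 with h0 | h0
    · exact absurd h0 hj.ne
    · linarith
  set s := (L * (1 - ρ) / ρ : ℚ)
  have hni : Complex.normSq (z i) = ((-ρ * s + L : ℚ) : ℝ) := by
    push_cast; rw [← hrj, ← hri]; simp [hr]
  have hnj : Complex.normSq (z j) = ((s + L : ℚ) : ℝ) := by
    push_cast; rw [← hrj]; simp [hr]
  refine ⟨i, j, _, _, hni, hnj, ?_, ?_⟩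
  · have : (((-ρ * s + L) * (s + L) : ℚ) : ℝ) = ((L ^ 2 : ℚ) : ℝ) := by
      push_cast
      rw [← hrj, ← hri]
      linear_combination hmul + L * hij
    exact_mod_cast this
  · have : ((L : ℚ) : ℝ) ≤ ((-ρ * s + L : ℚ) : ℝ) := by
      push_cast
      rw [← hrj, ← hri]
      linarith
    exact_mod_cast this

lemma pow_dvd_of_pow_dvd_mul_conj {R : Type*} [CommRing R] [IsDedekindDomain R] [CharZero R]
    {ζ : R} (hgen : Algebra.adjoin ℤ {ζ} = ⊤) (σ : R ≃+* R) (hσ : σ ζ * ζ = 1)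
    {p : ℕ} (hp : p.Prime) {s r : ℕ} (hζ : (ζ ^ (p ^ r + 1)) ^ p ^ s = 1)
    {b : ℕ} {x : R} (hx : (p : R) ^ (2 * b) ∣ x * σ x) : (p : R) ^ b ∣ x := by
  have := Fact.mk hp
  have hp0 : (p : R) ≠ 0 := by exact_mod_cast hp.ne_zero
  rw [← Ideal.span_singleton_le_span_singleton, ← Ideal.dvd_iff_le, ← Ideal.span_singleton_pow,
    UniqueFactorizationMonoid.dvd_iff_emultiplicity_le
      (pow_ne_zero _ (by simpa using hp0))]
  intro Q hQ
  by_cases hpQ : (p : R) ∈ Q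
  swap
  · rw [emultiplicity_pow hQ, emultiplicity_eq_zero.2]
    · simp
    · rwa [Ideal.dvd_span_singleton]
  have hQp : Q.IsPrime := Ideal.isPrime_of_prime hQ
  have hchar : CharP (R ⧸ Q) p := by
    have : Nontrivial (R ⧸ Q) := Ideal.Quotient.nontrivial_iff.2 hQp.ne_top
    refine (CharP.charP_iff_prime_eq_zero hp).2 ?_
    have := Ideal.Quotient.eq_zero_iff_mem.2 hpQ
    simpa using this
  have hζQ : Ideal.Quotient.mk Q ζ ^ (p ^ r + 1) = 1 := by
    apply iterateFrobenius_inj (R ⧸ Q) p s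
    rw [iterateFrobenius_def, iterateFrobenius_def, one_pow, ← map_pow, ← map_pow, hζ, map_one]
  have hfrob : ∀ y, Ideal.Quotient.mk Q (σ y) = Ideal.Quotient.mk Q y ^ p ^ r := by
    let f : R →ₐ[ℤ] R ⧸ Q := ((Ideal.Quotient.mk Q).comp (σ : R →+* R)).toIntAlgHom
    let g : R →ₐ[ℤ] R ⧸ Q :=
      ((iterateFrobenius (R ⧸ Q) p r).comp (Ideal.Quotient.mk Q)).toIntAlgHom
    have hfg : f = g := by
      refine AlgHom.ext_of_adjoin_eq_top hgen fun y hy => ?_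
      rw [Set.mem_singleton_iff] at hy
      subst hy
      change Ideal.Quotient.mk Q (σ y) = Ideal.Quotient.mk Q y ^ p ^ r
      have hu : Ideal.Quotient.mk Q (σ y) * Ideal.Quotient.mk Q y = 1 := by
        rw [← map_mul, hσ, map_one]
      calc Ideal.Quotient.mk Q (σ y)
          = Ideal.Quotient.mk Q (σ y) * Ideal.Quotient.mk Q y ^ (p ^ r + 1) := by
            rw [hζQ, mul_one]
        _ = (Ideal.Quotient.mk Q (σ y) * Ideal.Quotient.mk Q y) *
              Ideal.Quotient.mk Q y ^ p ^ r := by ring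
        _ = _ := by rw [hu, one_mul]
    exact fun y => DFunLike.congr_fun hfg y
  have hmem : ∀ y, σ y ∈ Q ↔ y ∈ Q := by
    intro y
    rw [← Ideal.Quotient.eq_zero_iff_mem, hfrob,
      pow_eq_zero_iff (pow_ne_zero _ hp.ne_zero), Ideal.Quotient.eq_zero_iff_mem]
  have hcomap : Q.map σ = Q := by
    ext y
    rw [Ideal.mem_map_of_equiv]
    constructor
    · rintro ⟨a, ha, rfl⟩
      exact (hmem a).2 ha
    · intro hy
      exact ⟨σ.symm y, (hmem _).1 (by simpa using hy), by simp⟩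
  have hmult : emultiplicity Q (Ideal.span {σ x}) = emultiplicity Q (Ideal.span {x}) := by
    rw [emultiplicity_eq_emultiplicity_iff]
    intro n
    rw [Ideal.dvd_span_singleton, Ideal.dvd_span_singleton]
    nth_rw 1 [← hcomap]
    rw [← Ideal.map_pow, Ideal.mem_map_of_equiv]
    simp
  have hdvd : (Ideal.span {(p : R)}) ^ (2 * b) ∣ Ideal.span {x} * Ideal.span {σ x} := by
    rw [Ideal.span_singleton_pow, Ideal.span_singleton_mul_span_singleton, Ideal.dvd_iff_le,
      Ideal.span_singleton_le_span_singleton]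
    exact hx
  have hle := emultiplicity_le_emultiplicity_of_dvd_right (a := Q) hdvd
  rw [emultiplicity_mul hQ, hmult, mul_comm 2 b, pow_mul, emultiplicity_pow hQ, ← two_mul] at hle
  rw [Nat.cast_ofNat] at hle
  exact (ENat.mul_le_mul_left_iff (by simp) (by exact ENat.natCast_ne_top 2)).1 hle

open Polynomial in
lemma X_pow_sub_one_dvd_cyclotomic_mul_prod {t : ℕ} (q : Fin t → ℕ) (hq : ∀ i, (q i).Prime) :
    (X ^ (∏ i, q i) - 1 : ℤ[X]) ∣
      cyclotomic (∏ i, q i) ℤ * ∏ i, (1 - X ^ ((∏ j, q j) / q i)) := by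
  set w := ∏ i, q i with hw
  have hw0 : 0 < w := Finset.prod_pos fun i _ => (hq i).pos
  have hmonic : (X ^ w - 1 : ℤ[X]).Monic := monic_X_pow_sub_C 1 hw0.ne'
  rw [← Polynomial.map_dvd_map (Int.castRingHom ℚ) Int.cast_injective hmonic]
  simp only [Polynomial.map_sub, Polynomial.map_pow, Polynomial.map_mul, Polynomial.map_prod,
    map_X, Polynomial.map_one, map_cyclotomic]
  rw [← prod_cyclotomic_eq_X_pow_sub_one hw0, ← Nat.cons_self_properDivisors hw0.ne',
    Finset.prod_cons]
  refine mul_dvd_mul_left _ (Finset.prod_dvd_of_coprime ?_ ?_)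
  · exact fun d _ d' _ hdd => cyclotomic.isCoprime_rat hdd
  · intro d hd
    obtain ⟨hd1, hd2⟩ := Nat.mem_properDivisors.1 hd
    obtain ⟨e, he⟩ := hd1
    have he1 : e ≠ 1 := by rintro rfl; omega
    obtain ⟨l, hl, hle⟩ := Nat.exists_prime_and_dvd he1
    have hlw : l ∣ ∏ i, q i := by rw [← hw, he]; exact hle.mul_left d
    obtain ⟨i, -, hi⟩ := (hl.prime.dvd_finsetProd_iff q).1 hlw
    rw [Nat.prime_dvd_prime_iff_eq hl (hq i)] at hi
    subst hi
    obtain ⟨f, rfl⟩ := hle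
    have hdw : d ∣ w / q i := by
      rw [he, show d * (q i * f) = q i * (d * f) by ring, Nat.mul_div_cancel_left _ (hq i).pos]
      exact dvd_mul_right d f
    refine Dvd.dvd.trans ?_ (Finset.dvd_prod_of_mem _ (Finset.mem_univ i))
    rw [← neg_sub, dvd_neg]
    obtain ⟨k, hk⟩ := hdw
    rw [hk, pow_mul]
    exact (cyclotomic.dvd_X_pow_sub_one d ℚ).trans
      (by simpa using sub_dvd_pow_sub_pow (X ^ d : ℚ[X]) 1 k)

namespace AddMonoidAlgebra

lemma coeff_mul_one_sub_single {M : Type*} [AddCommGroup M] (x : AddMonoidAlgebra ℤ M) (d c : M) :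
    (x * (1 - single d 1)).coeff c = x.coeff c - x.coeff (c - d) := by
  rw [mul_sub, mul_one, coeff_sub, Finsupp.sub_apply,
    coeff_mul_single_eq_coeff_mul (c - d) (by simp [eq_sub_iff_add_eq]), mul_one]

lemma abs_coeff_mul_prod_one_sub_single_le {M ι : Type*} [AddCommGroup M]
    {A : AddMonoidAlgebra ℤ M} {C : ℤ} (h0 : ∀ c, 0 ≤ A.coeff c) (hC : ∀ c, A.coeff c ≤ C)
    (d : ι → M) {s : Finset ι} (hs : s.Nonempty) (c : M) :
    |(A * ∏ i ∈ s, (1 - single (d i) 1)).coeff c| ≤ 2 ^ (s.card - 1) * C := by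
  induction hs using Finset.Nonempty.cons_induction generalizing c with
  | singleton i =>
    rw [Finset.prod_singleton, coeff_mul_one_sub_single, abs_le]
    simp only [Finset.card_singleton, le_refl, tsub_eq_zero_of_le, pow_zero, one_mul]
    constructor <;> linarith [h0 c, h0 (c - d i), hC c, hC (c - d i)]
  | cons i s hi hs ih =>
    rw [Finset.prod_cons, mul_comm (1 - _), ← mul_assoc, coeff_mul_one_sub_single,
      Finset.card_cons, Nat.add_sub_cancel, ← Nat.sub_add_cancel hs.card_pos, pow_succ]
    have h1 := abs_le.1 (ih c)
    have h2 := abs_le.1 (ih (c - d i))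
    rw [abs_le]
    constructor <;> linarith [h1.1, h1.2, h2.1, h2.2]

end AddMonoidAlgebra

open Polynomial AddMonoidAlgebra in
lemma eq_zero_of_dvd_of_coeff_le {K : Type*} [Field K] [CharZero K] {t : ℕ} (ht : 0 < t)
    (q : Fin t → ℕ) (hq : ∀ i, (q i).Prime) {w : ℕ} (hw : w = ∏ i, q i)
    {ζ : K} (hζ : IsPrimitiveRoot ζ w)
    (E : AddMonoidAlgebra ℤ (ZMod w) →ₐ[ℤ] K) (hE : E (single 1 1) = ζ)
    {A : AddMonoidAlgebra ℤ (ZMod w)} {C : ℤ} {n : ℕ}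
    (h0 : ∀ c, 0 ≤ A.coeff c) (hC : ∀ c, A.coeff c ≤ C) (hn : 2 ^ (t - 1) * C < n)
    {β : K} (hβ : β ∈ Algebra.adjoin ℤ {ζ}) (hA : E A = n * β) : E A = 0 := by
  have hw0 : 0 < w := hw ▸ Finset.prod_pos fun i _ => (hq i).pos
  have : NeZero w := ⟨hw0.ne'⟩
  set x : AddMonoidAlgebra ℤ (ZMod w) := single 1 1 with hx
  have hxpow : ∀ k : ℕ, x ^ k = single (k : ZMod w) 1 := by
    intro k
    rw [hx, single_pow]
    simp
  have hsurj : ∀ y : AddMonoidAlgebra ℤ (ZMod w), ∃ f : ℤ[X], aeval x f = y := by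
    intro y
    induction y using AddMonoidAlgebra.induction_on with
    | of c =>
      refine ⟨X ^ (Multiplicative.toAdd c : ZMod w).val, ?_⟩
      rw [map_pow, aeval_X, hxpow, ZMod.natCast_zmod_val]
      rfl
    | add y z hy hz =>
      obtain ⟨f, rfl⟩ := hy
      obtain ⟨g, rfl⟩ := hz
      exact ⟨f + g, map_add _ _ _⟩
    | smul r y hy =>
      obtain ⟨f, rfl⟩ := hy
      exact ⟨r • f, map_smul _ _ _⟩
  obtain ⟨g, hg⟩ : ∃ g : ℤ[X], aeval ζ g = β := by
    rwa [Algebra.adjoin_singleton_eq_range_aeval] at hβ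
  obtain ⟨f, hf⟩ := hsurj A
  have hfζ : aeval ζ f = E A := by rw [← hf, ← hE, aeval_algHom_apply]
  have hdvd : cyclotomic w ℤ ∣ f - (n : ℤ[X]) * g := by
    rw [cyclotomic_eq_minpoly hζ hw0]
    apply minpoly.isIntegrallyClosed_dvd (hζ.isIntegral hw0)
    rw [map_sub, map_mul, hfζ, hg, map_natCast, hA, sub_self]
  have hkill : aeval x ((f - (n : ℤ[X]) * g) * ∏ i, (1 - X ^ (w / q i))) = 0 := by
    have h1 : (X ^ w - 1 : ℤ[X]) ∣ (f - (n : ℤ[X]) * g) * ∏ i, (1 - X ^ (w / q i)) :=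
      (hw ▸ X_pow_sub_one_dvd_cyclotomic_mul_prod q hq).trans (mul_dvd_mul_right hdvd _)
    obtain ⟨k, hk⟩ := h1
    rw [hk, map_mul, map_sub, map_pow, aeval_X, hxpow, map_one, ZMod.natCast_self]
    simp [AddMonoidAlgebra.one_def]
  have hprod : aeval x (∏ i, (1 - X ^ (w / q i)) : ℤ[X]) =
      ∏ i, (1 - single ((w / q i : ℕ) : ZMod w) 1) := by
    simp only [map_prod, map_sub, map_pow, aeval_X, hxpow, map_one]
  set P := ∏ i, (1 - single ((w / q i : ℕ) : ZMod w) (1 : ℤ)) with hP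
  have hAP : A * P = (n : ℤ) • (aeval x g * P) := by
    rw [map_mul, hprod, map_sub, map_mul, hf, map_natCast] at hkill
    rw [zsmul_eq_mul, Int.cast_natCast]
    linear_combination hkill
  have hzero : A * P = 0 := by
    ext c
    have hb := abs_coeff_mul_prod_one_sub_single_le h0 hC
      (fun i : Fin t => ((w / q i : ℕ) : ZMod w)) (s := Finset.univ)
      ⟨⟨0, ht⟩, Finset.mem_univ _⟩ c
    rw [Finset.card_fin] at hb
    refine Int.eq_zero_of_abs_lt_dvd (m := n) ?_ (hb.trans_lt hn)
    rw [hAP, coeff_smul_apply, smul_eq_mul]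
    exact dvd_mul_right _ _
  have hEP : E P ≠ 0 := by
    rw [hP, map_prod, Finset.prod_ne_zero_iff]
    intro i _
    rw [map_sub, map_one, ← hxpow, map_pow, hE, sub_ne_zero]
    refine (hζ.pow_ne_one_of_pos_of_lt ?_ ?_).symm
    · exact (Nat.div_pos (Nat.le_of_dvd hw0 (hw ▸ Finset.dvd_prod_of_mem _ (Finset.mem_univ i)))
        (hq i).pos).ne'
    · exact Nat.div_lt_self hw0 (hq i).one_lt
  have := congrArg E hzero
  rw [map_mul, map_zero] at this
  exact (mul_eq_zero.1 this).resolve_right hEP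

lemma exists_monoidHom_orderOf_eq {G : Type*} [CommGroup G] [Finite G] {t : ℕ} (q : Fin t → ℕ)
    (hq : ∀ i, (q i).Prime) (hqinj : Function.Injective q) (hdvd : ∀ i, q i ∣ Nat.card G) :
    ∃ χ : G →* ℂˣ, orderOf χ = ∏ i, q i := by
  have hcop : ∏ i, q i ∣ Monoid.exponent G := by
    refine Finset.prod_dvd_of_isRelPrime (fun i _ j _ hij => ?_) fun i _ => ?_
    · exact Nat.coprime_iff_isRelPrime.1
        ((Nat.coprime_primes (hq i) (hq j)).2 fun h => hij (hqinj h))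
    · have := Fact.mk (hq i)
      obtain ⟨g, hg⟩ := exists_prime_orderOf_dvd_card' (q i) (hdvd i)
      exact hg ▸ Monoid.order_dvd_exponent g
  obtain ⟨g, hg⟩ := Monoid.exists_orderOf_eq_exponent (Monoid.ExponentExists.of_finite (G := G))
  have hexp : Monoid.exponent G ≠ 0 := Monoid.exponent_ne_zero_of_finite
  have : NeZero (Monoid.exponent G) := ⟨hexp⟩
  obtain ⟨e⟩ := CommGroup.monoidHom_mulEquiv_of_hasEnoughRootsOfUnity G ℂ
  refine ⟨e.symm (g ^ (orderOf g / ∏ i, q i)), ?_⟩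
  rw [MulEquiv.orderOf_eq, orderOf_pow_orderOf_div (hg ▸ hexp) (hg ▸ hcop)]

lemma orderOf_mul_card_fiber_le {G H : Type*} [CommGroup G] [Fintype G] [CommGroup H]
    [DecidableEq H] (χ : G →* H) (c : H) :
    orderOf χ * (Finset.univ.filter fun g => χ g = c).card ≤ Fintype.card G := by
  by_cases hc : c ∈ Set.range χ
  swap
  · rw [Finset.card_eq_zero.2, mul_zero]
    · exact Nat.zero_le _
    · exact Finset.filter_eq_empty_iff.2 fun g _ hg => hc ⟨g, hg⟩
  rw [MonoidHom.card_fiber_eq_of_mem_range χ hc ⟨1, map_one χ⟩, ← Nat.card_eq_fintype_card,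
    ← χ.ker.card_mul_index, mul_comm, Subgroup.index_ker]
  have hker : (Finset.univ.filter fun g => χ g = 1).card = Nat.card χ.ker := by
    rw [Nat.card_eq_fintype_card, Fintype.card_subtype]
    simp [MonoidHom.mem_ker]
  rw [hker]
  refine Nat.mul_le_mul_left _ (Nat.le_of_dvd Nat.card_pos (orderOf_dvd_of_pow_eq_one ?_))
  ext g
  have := pow_card_eq_one' (x := (⟨χ g, g, rfl⟩ : χ.range))
  simpa using congrArg Subtype.val this

open ComplexConjugate in
lemma sum_sub_mul_conj_eq_neg {G : Type*} [CommGroup G] [Fintype G] [DecidableEq G] {m lam : ℕ}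
    {D : Fin m → Finset G}
    (hD : ∀ j : Fin m, ∀ g : G,
      (∑ l ∈ Finset.univ.filter (fun l => l ≠ j),
        (((D l) ×ˢ (D j)).filter (fun x => x.1 * x.2⁻¹ = g)).card) = if g = 1 then 0 else lam)
    {χ : G →* ℂˣ} (hχ : χ ≠ 1) (j : Fin m) :
    (∑ i, ∑ g ∈ D i, (χ g : ℂ) - ∑ g ∈ D j, (χ g : ℂ)) * conj (∑ g ∈ D j, (χ g : ℂ)) =
      -(lam : ℂ) := by
  have hconj : ∀ g, conj (χ g : ℂ) = (χ g⁻¹ : ℂˣ) := by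
    intro g
    rw [map_inv, Units.val_inv_eq_inv_val, Complex.inv_def, Complex.normSq_eq_norm_sq,
      Complex.norm_eq_one_of_pow_eq_one (n := Fintype.card G) ?_ Fintype.card_ne_zero]
    · simp
    · rw [← Units.val_pow_eq_pow_val, ← map_pow, pow_card_eq_one, map_one, Units.val_one]
  have hsum0 : ∑ g, (χ g : ℂ) = 0 := by
    refine sum_hom_units_eq_zero ((Units.coeHom ℂ).comp χ) fun h => hχ ?_
    ext g
    exact DFunLike.congr_fun h g
  have hsplit : ∑ i, ∑ g ∈ D i, (χ g : ℂ) - ∑ g ∈ D j, (χ g : ℂ) =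
      ∑ l ∈ Finset.univ.filter (fun l => l ≠ j), ∑ g ∈ D l, (χ g : ℂ) := by
    rw [Finset.filter_ne', ← Finset.sum_erase_add _ _ (Finset.mem_univ j), add_sub_cancel_right]
  rw [hsplit, Finset.sum_mul]
  calc _ = ∑ l ∈ Finset.univ.filter (fun l => l ≠ j), ∑ x ∈ D l ×ˢ D j,
        (χ (x.1 * x.2⁻¹) : ℂ) := by
        refine Finset.sum_congr rfl fun l _ => ?_
        rw [map_sum, Finset.sum_mul_sum, Finset.sum_product]
        simp only [hconj, map_mul, Units.val_mul]
    _ = ∑ l ∈ Finset.univ.filter (fun l => l ≠ j), ∑ g,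
        ((((D l) ×ˢ (D j)).filter (fun x => x.1 * x.2⁻¹ = g)).card : ℂ) * (χ g : ℂ) := by
        refine Finset.sum_congr rfl fun l _ => ?_
        rw [← Finset.sum_fiberwise _ (fun x : G × G => x.1 * x.2⁻¹)]
        refine Finset.sum_congr rfl fun g _ => ?_
        rw [← nsmul_eq_mul, ← Finset.sum_const]
        exact Finset.sum_congr rfl fun x hx => by rw [(Finset.mem_filter.1 hx).2]
    _ = ∑ g, (if g = 1 then 0 else (lam : ℂ)) * (χ g : ℂ) := by
        rw [Finset.sum_comm]
        refine Finset.sum_congr rfl fun g _ => ?_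
        rw [← Finset.sum_mul, ← Nat.cast_sum, hD j g]
        simp
    _ = ∑ g, ((lam : ℂ) * χ g - if g = 1 then (lam : ℂ) else 0) := by
        refine Finset.sum_congr rfl fun g _ => ?_
        split_ifs with h <;> simp [h]
    _ = _ := by
        rw [Finset.sum_sub_distrib, ← Finset.mul_sum, hsum0]
        simp

open NumberField ComplexConjugate in
lemma exists_characterSum_eq_prime_pow_mul {G : Type*} [CommGroup G] [Fintype G] [DecidableEq G]
    {m : ℕ} (hm : 2 < m) {D : Fin m → Finset G} {p b : ℕ} (hp : p.Prime)
    (hD : ∀ j : Fin m, ∀ g : G,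
      (∑ l ∈ Finset.univ.filter (fun l => l ≠ j),
        (((D l) ×ˢ (D j)).filter (fun x => x.1 * x.2⁻¹ = g)).card) =
          if g = 1 then 0 else p ^ (2 * b))
    {χ : G →* ℂˣ} (hχ1 : χ ≠ 1) {w : ℕ} [NeZero w] (hsc : SelfConjPrime p w)
    {K : Type*} [Field K] [NumberField K] [IsCyclotomicExtension {w} ℚ K] {ζ : K}
    (hζ : IsPrimitiveRoot ζ w) (φ : K →+* ℂ) {e : G → ℕ} (he : ∀ g, φ ζ ^ e g = χ g) :
    ∃ j, ∃ β ∈ Algebra.adjoin ℤ {ζ}, ∑ g ∈ D j, ζ ^ e g = (p : K) ^ b * β := by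
  algebraize [φ]
  have : Normal ℚ K := (IsCyclotomicExtension.isGalois {w} ℚ K).to_normal
  let c : Gal(K/ℚ) := (Complex.conjAe.restrictScalars ℚ).restrictNormal K
  have hc : ∀ y, φ (c y) = conj (φ y) := fun y =>
    (Complex.conjAe.restrictScalars ℚ).restrictNormal_commutes K y
  let σ : 𝓞 K ≃+* 𝓞 K := RingOfIntegers.mapRingEquiv c.toRingEquiv
  have hσ : ∀ y, φ (algebraMap (𝓞 K) K (σ y)) = conj (φ (algebraMap (𝓞 K) K y)) := fun y => hc y
  have hιζ : algebraMap (𝓞 K) K hζ.toInteger = ζ := rfl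
  have hφζ : IsPrimitiveRoot (φ ζ) w := hζ.map_of_injective φ.injective
  have hσζ : σ hζ.toInteger * hζ.toInteger = 1 := by
    apply RingOfIntegers.coe_injective
    apply φ.injective
    rw [map_mul, map_mul, hσ, mul_comm, Complex.mul_conj, Complex.normSq_eq_norm_sq, map_one,
      map_one, hιζ, Complex.norm_eq_one_of_pow_eq_one hφζ.pow_eq_one (NeZero.ne w)]
    simp
  let x : Fin m → 𝓞 K := fun j => ∑ g ∈ D j, hζ.toInteger ^ e g
  have hx : ∀ j, φ (algebraMap (𝓞 K) K (x j)) = ∑ g ∈ D j, (χ g : ℂ) := by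
    intro j
    simp only [x, map_sum, map_pow, hιζ, he]
  have hsum := sum_sub_mul_conj_eq_neg hD hχ1
  have hint : ∀ j, ∀ r : ℚ, Complex.normSq (∑ g ∈ D j, (χ g : ℂ)) = r →
      ∃ N : ℤ, r = N ∧ x j * σ (x j) = N := by
    intro j r hr
    have h1 : algebraMap (𝓞 K) K (x j * σ (x j)) = algebraMap ℚ K r := by
      apply φ.injective
      rw [map_mul, map_mul, hσ, Complex.mul_conj, hx, hr]
      simp
    have h2 : IsIntegral ℤ r :=
      (isIntegral_algebraMap_iff (algebraMap ℚ K).injective).1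
        (h1 ▸ RingOfIntegers.isIntegral_coe _)
    obtain ⟨N, rfl⟩ := IsIntegrallyClosed.isIntegral_iff.1 h2
    refine ⟨N, rfl, RingOfIntegers.coe_injective ?_⟩
    rw [h1]
    simp
  obtain ⟨j, j', r, r', hr, hr', hrr, hle⟩ :=
    exists_rational_normSq_of_strong_sum hm _ (pow_pos hp.pos (2 * b)) hsum
  obtain ⟨N, rfl, hN⟩ := hint j r hr
  obtain ⟨N', rfl, -⟩ := hint j' r' hr'
  have hpN : (p : ℤ) ^ (2 * b) ∣ N := by
    have hNN : N * N' = ((p ^ (2 * b)) ^ 2 : ℕ) := by exact_mod_cast hrr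
    have hNle : ((p ^ (2 * b) : ℕ) : ℤ) ≤ N := by exact_mod_cast hle
    lift N to ℕ using (Int.natCast_nonneg _).trans hNle
    have hdvd : N ∣ p ^ (2 * b * 2) := by
      rw [pow_mul]
      exact Int.natCast_dvd_natCast.1 ⟨N', hNN.symm⟩
    obtain ⟨k, -, rfl⟩ := (Nat.dvd_prime_pow hp).1 hdvd
    have : 2 * b ≤ k := (Nat.pow_le_pow_iff_right hp.one_lt).1 (by exact_mod_cast hNle)
    exact_mod_cast pow_dvd_pow p this
  obtain ⟨s, hs⟩ := hsc
  set f := w.factorization p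
  have hwpow : w ∣ (p ^ s + 1) * p ^ f := by
    have h1 : w / p ^ f ∣ p ^ s + 1 := by
      rw [← ZMod.natCast_eq_zero_iff]
      push_cast
      rw [hs]; ring
    calc w = w / p ^ f * p ^ f := (Nat.div_mul_cancel (Nat.ordProj_dvd w p)).symm
      _ ∣ _ := mul_dvd_mul_right h1 _
  have hxdvd : (p : 𝓞 K) ^ b ∣ x j := by
    refine pow_dvd_of_pow_dvd_mul_conj (IsCyclotomicExtension.Rat.adjoin_singleton_eq_top hζ) σ hσζ
      hp (s := f) (r := s) ?_ ?_
    · rw [← pow_mul]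
      exact (hζ.toInteger_isPrimitiveRoot.pow_eq_one_iff_dvd _).2 hwpow
    · rw [hN]
      simpa using map_dvd (Int.castRingHom (𝓞 K)) hpN
  obtain ⟨β, hβ⟩ := hxdvd
  have hβmem : algebraMap (𝓞 K) K β ∈ Algebra.adjoin ℤ {ζ} := by
    have := IsCyclotomicExtension.Rat.isIntegralClosure_adjoin_singleton hζ
    obtain ⟨y, hy⟩ := (IsIntegralClosure.isIntegral_iff (A := Algebra.adjoin ℤ {ζ})).1
      (RingOfIntegers.isIntegral_coe β)
    rw [← hy]
    exact y.2
  refine ⟨j, algebraMap (𝓞 K) K β, hβmem, ?_⟩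
  have := congrArg (algebraMap (𝓞 K) K) hβ
  simpa [x, hιζ] using this

/-- Nonexistence of `((m-1)p₁^{2a}+1, m, p₁^a p₂^b, p₂^{2b})`-SEDFs when `q_1, …, q_t`
are distinct primes dividing `(m-1)p₁^{2a}+1`, `p₂` is self-conjugate modulo `q_1⋯q_t`,
and `q_1⋯q_t·p₂^b > 2^{t-1}·((m-1)p₁^{2a} + 1)`. -/
theorem sedf_nonexistence_mixed_primes
    (p₁ p₂ : ℕ) (hp₁ : p₁.Prime) (hp₂ : p₂.Prime) (hne : p₁ ≠ p₂)
    (m a b : ℕ) (hm : 2 < m) (ha : 0 < a) (hb : 0 < b)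
    (t : ℕ) (q : Fin t → ℕ) (hq : ∀ i, (q i).Prime) (hqinj : Function.Injective q)
    (hqdvd : ∀ i, q i ∣ (m - 1) * p₁ ^ (2 * a) + 1)
    (hsc : SelfConjPrime p₂ (∏ i, q i))
    (hineq : (∏ i, q i) * p₂ ^ b > 2 ^ (t - 1) * ((m - 1) * p₁ ^ (2 * a) + 1)) :
    ∀ (G : Type) [CommGroup G] [Fintype G] [DecidableEq G] (D : Fin m → Finset G),
      Fintype.card G = (m - 1) * p₁ ^ (2 * a) + 1 →
      ¬ IsSEDF D (p₁ ^ a * p₂ ^ b) (p₂ ^ (2 * b)) := by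
  intro G _ _ _ D hcard hS
  obtain ⟨-, -, -, hDk, -, hD⟩ := hS
  rw [← hcard] at hqdvd hineq
  rcases Nat.eq_zero_or_pos t with rfl | ht
  · have h1 : p₁ ^ a * p₂ ^ b ≤ Fintype.card G :=
      hDk ⟨0, by omega⟩ ▸ Finset.card_le_univ _
    have h2 : p₂ ^ b ≤ p₁ ^ a * p₂ ^ b := Nat.le_mul_of_pos_left _ (pow_pos hp₁.pos a)
    simp only [Finset.univ_eq_empty, Finset.prod_empty, one_mul, Nat.zero_sub, pow_zero] at hineq
    omega
  obtain ⟨χ, hχ⟩ := exists_monoidHom_orderOf_eq (G := G) q hq hqinj (by simpa using hqdvd)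
  obtain ⟨w, hw⟩ : ∃ w, w = ∏ i, q i := ⟨_, rfl⟩
  rw [← hw] at hχ hsc hineq
  have hw1 : 1 < w := by
    rw [hw]
    exact (hq ⟨0, ht⟩).one_lt.trans_le (Nat.le_of_dvd (Finset.prod_pos fun i _ => (hq i).pos)
      (Finset.dvd_prod_of_mem q (Finset.mem_univ _)))
  have : NeZero w := ⟨by omega⟩
  have hχ1 : χ ≠ 1 := by
    rintro rfl
    rw [orderOf_one] at hχ
    omega
  obtain ⟨K, _, _, _⟩ : ∃ (K : Type) (_ : Field K) (_ : NumberField K),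
      IsCyclotomicExtension {w} ℚ K := by
    refine ⟨CyclotomicField w ℚ, inferInstance, inferInstance, ?_⟩
    convert CyclotomicField.isCyclotomicExtension w ℚ
    · rfl
    · exact Subsingleton.elim _ _
  have hζ := IsCyclotomicExtension.zeta_spec w ℚ K
  set ζ := IsCyclotomicExtension.zeta w ℚ K
  obtain ⟨φ⟩ : Nonempty (K →+* ℂ) := inferInstance
  have hφζ : IsPrimitiveRoot (φ ζ) w := hζ.map_of_injective φ.injective
  have hroot : ∀ g, ∃ i < w, φ ζ ^ i = χ g := by
    intro g
    apply hφζ.eq_pow_of_pow_eq_one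
    rw [← Units.val_pow_eq_pow_val, ← MonoidHom.pow_apply, ← hχ, pow_orderOf_eq_one]
    simp
  choose e _ he using hroot
  obtain ⟨j, β, hβmem, hβ⟩ :=
    exists_characterSum_eq_prime_pow_mul hm hp₂ hD hχ1 hsc hζ φ he
  let E : AddMonoidAlgebra ℤ (ZMod w) →ₐ[ℤ] K :=
    AddMonoidAlgebra.lift ℤ _ (ZMod w) (AddChar.zmodChar w hζ.pow_eq_one).toMonoidHom
  have hE : ∀ k : ℕ, E (.single (k : ZMod w) 1) = ζ ^ k := by
    intro k
    simp only [E, AddMonoidAlgebra.lift_single, one_smul]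
    exact AddChar.zmodChar_apply' hζ.pow_eq_one k
  let A : AddMonoidAlgebra ℤ (ZMod w) := ∑ g ∈ D j, .single (e g : ZMod w) 1
  have hEA : E A = ∑ g ∈ D j, ζ ^ e g := by
    simp only [A, map_sum, hE]
  have hcoeff : ∀ d, A.coeff d = ((D j).filter fun g => (e g : ZMod w) = d).card := by
    intro d
    simp only [A, AddMonoidAlgebra.coeff_sum, AddMonoidAlgebra.coeff_single,
      Finsupp.finsetSum_apply, Finsupp.single_apply]
    simp
  have hfib : ∀ d, ((D j).filter fun g => (e g : ZMod w) = d).card ≤ Fintype.card G / w := by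
    intro d
    rw [Nat.le_div_iff_mul_le (by omega), mul_comm]
    refine le_trans (Nat.mul_le_mul hχ.ge (Finset.card_le_card fun g hg => ?_))
      (orderOf_mul_card_fiber_le χ ((hφζ.isUnit (by omega)).unit ^ d.val))
    rw [Finset.mem_filter] at hg ⊢
    refine ⟨Finset.mem_univ g, Units.ext ?_⟩
    rw [← he g, ← hg.2, ZMod.val_natCast, Units.val_pow_eq_pow_val, IsUnit.unit_spec,
      ← pow_mod_orderOf, ← hφζ.eq_orderOf]
  have hzero : E A = 0 := by
    refine eq_zero_of_dvd_of_coeff_le ht q hq hw hζ E (by simpa using hE 1) (n := p₂ ^ b)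
      (C := (Fintype.card G / w : ℕ)) ?_ ?_ ?_ hβmem ?_
    · intro d; rw [hcoeff]; positivity
    · intro d; rw [hcoeff]; exact_mod_cast hfib d
    · have h1 : 2 ^ (t - 1) * (Fintype.card G / w) < p₂ ^ b := by
        refine lt_of_mul_lt_mul_left (a := w) (lt_of_le_of_lt ?_ hineq) (Nat.zero_le _)
        calc w * (2 ^ (t - 1) * (Fintype.card G / w))
            = 2 ^ (t - 1) * (w * (Fintype.card G / w)) := by ring
          _ ≤ _ := Nat.mul_le_mul_left _ (Nat.mul_div_le _ _)
      exact_mod_cast h1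
    · rw [hEA, hβ]
      simp
  have hsum0 : ∑ g ∈ D j, (χ g : ℂ) = 0 := by
    rw [← map_zero φ, ← hzero, hEA, map_sum]
    simp only [map_pow, he]
  have := sum_sub_mul_conj_eq_neg hD hχ1 j
  rw [hsum0, map_zero, mul_zero] at this
  have hp0 : (p₂ : ℂ) ≠ 0 := by exact_mod_cast hp₂.ne_zero
  simp [hp0] at this
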